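/- Let T be a cop-win tree of infinite radius. Then the set θ(T) induces a connected subgraph of T of diameter at most two. -/

import Mathlib

universe u

open Ordinal

open Classical in
/-- The Nowakowski–Winkler relations `≤_α`: `u ≤_0 v` iff `u = v`; for `α > 0`,
`u ≤_α v` iff every `x ∈ N[u]` has some `y ∈ N[v]` with `x ≤_β y` for some `β < α`. -/
noncomputable def crRel {V : Type u} (G : SimpleGraph V) (α : Ordinal.{u}) (a b : V) : Prop :=
  if α = 0 then a = b
  else ∀ x ∈ insert a (G.neighborSet a), ∃ y ∈ insert b (G.neighborSet b),
    ∃ β : Ordinal.{u}, ∃ _ : β < α, crRel G β x y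
termination_by α
decreasing_by assumption

/-- The CR-ordinal `ρ(G)`: the least ordinal where the tower `≤_α` stabilizes. -/
noncomputable def CRord {V : Type u} (G : SimpleGraph V) : Ordinal.{u} :=
  sInf {ρ : Ordinal.{u} | crRel G ρ = crRel G (ρ + 1)}

/-- `G` is cop-win when the stabilized relation is trivial. -/
def CopWin {V : Type u} (G : SimpleGraph V) : Prop :=
  ∀ a b : V, crRel G (CRord G) a b

/-- `η(u, v)`: least `α` with `u ≤_α v`. -/
noncomputable def etaPair {V : Type u} (G : SimpleGraph V) (a b : V) : Ordinal.{u} :=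
  sInf {α : Ordinal.{u} | crRel G α a b}

/-- `η(v) = sup_u η(u, v)`. -/
noncomputable def etaVert {V : Type u} (G : SimpleGraph V) (b : V) : Ordinal.{u} :=
  ⨆ a : V, etaPair G a b

/-- `η(G) = min_v η(v)`. -/
noncomputable def etaG {V : Type u} (G : SimpleGraph V) : Ordinal.{u} :=
  ⨅ b : V, etaVert G b

/-- `θ(G)`: the vertices realizing `η(G)`. -/
def theta {V : Type u} (G : SimpleGraph V) : Set V :=
  {b | etaVert G b = etaG G}

/-- Eccentricity of a vertex, as an extended natural number. -/
noncomputable def ecc {V : Type u} (G : SimpleGraph V) (v : V) : ℕ∞ :=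
  ⨆ u : V, G.edist v u

/-- Radius: minimum eccentricity. -/
noncomputable def radius {V : Type u} (G : SimpleGraph V) : ℕ∞ :=
  ⨅ v : V, ecc G v

/-- Diameter: supremum of distances. -/
noncomputable def diam {V : Type u} (G : SimpleGraph V) : ℕ∞ :=
  ⨆ u : V, ⨆ v : V, G.edist u v

section

variable {V : Type u} {G : SimpleGraph V}

/-- Every walk from `u` to `v` passes through `w`. -/
def SimpleGraph.Separates (G : SimpleGraph V) (w u v : V) : Prop :=
  ∀ p : G.Walk u v, w ∈ p.support

namespace SimpleGraph.Separates

variable {u v w x y : V}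

theorem symm (h : G.Separates w u v) : G.Separates w v u := fun p => by
  simpa using h p.reverse

theorem of_mem_left (h : G.Separates w u v) (hu : w ≠ u)
    (hx : x ∈ insert u (G.neighborSet u)) : G.Separates w x v := by
  rcases hx with rfl | hx
  · exact h
  · intro p
    have hp := h (.cons (show G.Adj u x from hx) p)
    rw [SimpleGraph.Walk.support_cons, List.mem_cons] at hp
    exact hp.resolve_left hu

theorem of_mem_right (h : G.Separates w u v) (hv : w ≠ v)
    (hy : y ∈ insert v (G.neighborSet v)) : G.Separates w u y :=
  (h.symm.of_mem_left hv hy).symm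

theorem or_of_separates (h : G.Separates w u v) (x : V) :
    G.Separates w x u ∨ G.Separates w x v := by
  by_contra! hc
  simp only [Separates, not_forall] at hc
  obtain ⟨⟨p, hp⟩, q, hq⟩ := hc
  have hpq := h (p.reverse.append q)
  simp [SimpleGraph.Walk.mem_support_append_iff, hp, hq] at hpq

theorem of_isPath (hG : G.IsTree) {p : G.Walk u v} (hp : p.IsPath) (hw : w ∈ p.support) :
    G.Separates w u v := by
  classical
  intro q
  have hpq : p = q.bypass :=
    congrArg Subtype.val
      ((hG.isAcyclic.subsingleton_path u v).elim ⟨p, hp⟩ ⟨q.bypass, q.bypass_isPath⟩)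
  exact q.support_bypass_subset_support (hpq ▸ hw)

theorem or_of_adj (hG : G.IsTree) (h : G.Adj v w) (u : V) :
    G.Separates w u v ∨ G.Separates v u w := by
  obtain ⟨p, hp, -⟩ := hG.existsUnique_path u v
  by_cases hw : w ∈ p.support
  · exact .inl (of_isPath hG hp hw)
  · exact .inr (of_isPath hG (hp.concat hw h) (by simp [SimpleGraph.Walk.support_concat]))

end SimpleGraph.Separates

open SimpleGraph

theorem crRel_zero {a b : V} : crRel G 0 a b ↔ a = b := by
  rw [crRel, if_pos rfl]

theorem crRel_of_ne_zero {α : Ordinal.{u}} (hα : α ≠ 0) {a b : V} :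
    crRel G α a b ↔ ∀ x ∈ insert a (G.neighborSet a), ∃ y ∈ insert b (G.neighborSet b),
      ∃ β < α, crRel G β x y := by
  rw [crRel, if_neg hα]
  simp only [exists_prop]

theorem crRel_refl (α : Ordinal.{u}) (a : V) : crRel G α a a := by
  rcases eq_or_ne α 0 with rfl | hα
  · exact crRel_zero.2 rfl
  · exact (crRel_of_ne_zero hα).2 fun x hx =>
      ⟨x, hx, 0, pos_iff_ne_zero.2 hα, crRel_zero.2 rfl⟩

theorem crRel.mono {α γ : Ordinal.{u}} (h : α ≤ γ) {a b : V} (hab : crRel G α a b) :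
    crRel G γ a b := by
  rcases eq_or_ne α 0 with rfl | hα
  · rw [crRel_zero.1 hab]
    exact crRel_refl γ b
  · have hγ : γ ≠ 0 := ((pos_iff_ne_zero.2 hα).trans_le h).ne'
    rw [crRel_of_ne_zero hα] at hab
    refine (crRel_of_ne_zero hγ).2 fun x hx => ?_
    obtain ⟨y, hy, β, hβ, hxy⟩ := hab x hx
    exact ⟨y, hy, β, hβ.trans_le h, hxy⟩

/-- Moving to a vertex which separates the two players never hurts the cop. -/
theorem crRel.of_separates {α : Ordinal.{u}} {u v w : V} (h : crRel G α u v)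
    (hs : G.Separates w u v) : crRel G α u w := by
  induction α using WellFoundedLT.induction generalizing u v with
  | ind α ih =>
    rcases eq_or_ne w u with rfl | hu
    · exact crRel_refl α w
    rcases eq_or_ne w v with rfl | hv
    · exact h
    rcases eq_or_ne α 0 with rfl | hα
    · obtain rfl := crRel_zero.1 h
      exact absurd (hs .nil) (by simpa using hu)
    · rw [crRel_of_ne_zero hα] at h ⊢
      intro x hx
      obtain ⟨y, hy, β, hβ, hxy⟩ := h x hx
      exact ⟨w, .inl rfl, β, hβ, ih β hβ hxy ((hs.of_mem_left hu hx).of_mem_right hv hy)⟩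

/-- In a tree, a robber in a branch at the cop's vertex survives no longer than one at the root of
that branch. -/
theorem crRel.of_separates_of_adj (hG : G.IsTree) {κ : Ordinal.{u}} {u v w : V}
    (h : crRel G κ w v) (hvw : G.Adj v w) (hs : G.Separates w u v) : crRel G κ u v := by
  induction κ using WellFoundedLT.induction generalizing u v w with
  | ind κ ih =>
    rcases eq_or_ne w u with rfl | hu
    · exact h
    have hκ : κ ≠ 0 := by
      rintro rfl
      exact hvw.ne' (crRel_zero.1 h)
    rw [crRel_of_ne_zero hκ] at h ⊢
    intro x hx
    have hsx := hs.of_mem_left hu hx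
    obtain ⟨p, hp, -⟩ := hG.existsUnique_path w x
    cases p with
    | nil => exact ⟨w, .inr hvw, 0, pos_iff_ne_zero.2 hκ, crRel_zero.2 rfl⟩
    | @cons _ z _ hwz q =>
      have hq := ((Walk.cons_isPath_iff hwz q).1 hp).2
      obtain ⟨y, hy, β, hβ, hzy⟩ := h z (.inr hwz)
      have hsz : G.Separates w z v := by
        refine (hsx.or_of_separates z).resolve_left fun hc => hq (hc q)
      have hzw := hzy.of_separates (hsz.of_mem_right hvw.ne' hy)
      exact ⟨w, .inr hvw, β, hβ, ih β hβ hzw hwz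
        (Separates.of_isPath hG hp (by simp)).symm⟩

theorem etaVert_le {α : Ordinal.{u}} {b : V} (h : ∀ a, crRel G α a b) : etaVert G b ≤ α :=
  ciSup_le' fun a => csInf_le' (h a)

theorem CopWin.crRel_etaVert (h : CopWin G) (a b : V) : crRel G (etaVert G b) a b :=
  crRel.mono (le_ciSup (f := fun a => etaPair G a b) Ordinal.bddAbove_of_small a)
    (csInf_mem (s := {α : Ordinal.{u} | crRel G α a b}) ⟨_, h a b⟩)

theorem etaG_le_etaVert (b : V) : etaG G ≤ etaVert G b :=
  ciInf_le' _ b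

theorem theta_nonempty [Nonempty V] : (theta G).Nonempty :=
  ciInf_mem (etaVert G)

theorem CopWin.mem_theta_of_separates (h : CopWin G) {a b w : V} (ha : a ∈ theta G)
    (hb : b ∈ theta G) (hs : G.Separates w a b) : w ∈ theta G := by
  refine le_antisymm (etaVert_le fun u => ?_) (etaG_le_etaVert w)
  rcases hs.or_of_separates u with hu | hu
  · exact (ha ▸ h.crRel_etaVert u a).of_separates hu
  · exact (hb ▸ h.crRel_etaVert u b).of_separates hu

theorem CopWin.exists_lt_crRel_of_separates (h : CopWin G) {a p q : V} (ha : a ∈ theta G)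
    (hap : p ≠ a) (hqa : q ≠ a) (hs : G.Separates p q a) : ∃ β < etaG G, crRel G β q p := by
  have hq := ha ▸ h.crRel_etaVert q a
  have h0 : etaG G ≠ 0 := fun h0 => hqa (crRel_zero.1 (h0 ▸ hq))
  rw [crRel_of_ne_zero h0] at hq
  obtain ⟨y, hy, β, hβ, hqy⟩ := hq q (.inl rfl)
  exact ⟨β, hβ, hqy.of_separates (hs.of_mem_right hap hy)⟩

theorem CopWin.length_le_two_of_mem_theta (h : CopWin G) (hG : G.IsTree) {a b : V}
    (ha : a ∈ theta G) (hb : b ∈ theta G) {w : G.Walk a b} (hw : w.IsPath) : w.length ≤ 2 := by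
  match w, hw with
  | .nil, _ => simp
  | .cons _ .nil, _ => simp
  | .cons _ (.cons _ .nil), _ => simp
  | @Walk.cons _ _ _ p _ hap (.cons (v := q) hpq (.cons hqc r)), hw =>
    exfalso
    have hw' := hw
    simp only [Walk.cons_isPath_iff, Walk.support_cons, List.mem_cons, not_or] at hw'
    obtain ⟨⟨⟨-, hqr⟩, -, hpr⟩, -, haq, -⟩ := hw'
    have hqb : q ≠ b := fun e => hqr (e ▸ r.end_mem_support)
    have hpb : p ≠ b := fun e => hpr (e ▸ r.end_mem_support)
    have hspa : G.Separates p q a :=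
      (Separates.of_isPath hG (p := .cons hap (.cons hpq .nil)) (by
        simp [hap.ne, hpq.ne, haq]) (by simp)).symm
    have hsqb : G.Separates q p b := Separates.of_isPath hG hw.of_cons (by simp)
    obtain ⟨β, hβ, hqp⟩ := h.exists_lt_crRel_of_separates ha hap.ne' (Ne.symm haq) hspa
    obtain ⟨γ, hγ, hpq'⟩ := h.exists_lt_crRel_of_separates hb hqb hpb hsqb
    have hle : etaVert G p ≤ max β γ := etaVert_le fun u => by
      rcases Separates.or_of_adj hG hpq u with hu | hu
      · exact (hqp.of_separates_of_adj hG hpq hu).mono (le_max_left _ _)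
      · exact ((hpq'.of_separates_of_adj hG hpq.symm hu).of_separates hu).mono (le_max_right _ _)
    exact ((etaG_le_etaVert p).trans hle).not_gt (max_lt hβ hγ)

theorem CopWin.exists_walk_induce_theta (h : CopWin G) (hG : G.IsTree) (a b : theta G) :
    ∃ w : (G.induce (theta G)).Walk a b, w.length ≤ 2 := by
  obtain ⟨p, hp, -⟩ := hG.existsUnique_path (a : V) b
  refine ⟨p.induce (theta G) fun w hw =>
    h.mem_theta_of_separates a.2 b.2 (Separates.of_isPath hG hp hw), ?_⟩
  rw [← Walk.length_map (Embedding.induce (theta G)).toHom, Walk.map_induce]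
  exact h.length_le_two_of_mem_theta hG a.2 b.2 hp

end

/-- For a cop-win tree of infinite radius, `θ(T)` induces a connected subgraph of
diameter at most two. -/
theorem theta_induces_connected_diam_le_two {V : Type u} (T : SimpleGraph V)
    (hT : T.IsTree) (hwin : CopWin T) (hrad : radius T = ⊤) :
    (T.induce (theta T)).Connected ∧ diam (T.induce (theta T)) ≤ 2 := by
  have := hT.connected.nonempty
  have hne : Nonempty (theta T) := theta_nonempty.to_subtype
  refine ⟨⟨fun a b => ?_⟩, iSup_le fun a => iSup_le fun b => ?_⟩
  · exact (hwin.exists_walk_induce_theta hT a b).choose.reachable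
  · obtain ⟨w, hw⟩ := hwin.exists_walk_induce_theta hT a b
    exact (SimpleGraph.edist_le w).trans (by exact_mod_cast hw)
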